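/- Let (X, Y) be jointly centered Gaussian with Var X = Var Y = 1 and E[XY] = ρ, and let Φ be the standard normal CDF. Then E[Φ(X)Φ(Y)] = 1/4 + ∑_{q≥0} ℓ_{2q+1}² (2q+1)! ρ^{2q+1}, where ℓ_{2q+1} = (-1)^q / (√π · (2q+1) · 2^{2q+1} · q!). -/

import Mathlib

open MeasureTheory ProbabilityTheory

theorem Ring.choose_half_add_sub_one_eq_centralBinom_div (n : ℕ) :
    Ring.choose ((1 / 2 : ℝ) + n - 1) n = (n.centralBinom : ℝ) / 4 ^ n := by
  have hchoose : (n.factorial : ℝ) * Ring.choose ((1 / 2 : ℝ) + n - 1) n =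
      (ascPochhammer ℝ n).eval (1 / 2) := by
    rw [← Ring.multichoose_eq, ← nsmul_eq_mul, Ring.factorial_nsmul_multichoose_eq_ascPochhammer,
      Polynomial.ascPochhammer_smeval_eq_eval]
  have hpoch : ∀ k : ℕ, (ascPochhammer ℝ k).eval (1 / 2) =
      k.factorial * ((k.centralBinom : ℝ) / 4 ^ k) := by
    intro k
    induction k with
    | zero => simp
    | succ k ih =>
      have h : ((k : ℝ) + 1) * (k + 1).centralBinom = 2 * (2 * k + 1) * k.centralBinom := by
        exact_mod_cast Nat.succ_mul_centralBinom_succ k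
      rw [ascPochhammer_succ_eval, ih, Nat.factorial_succ, pow_succ]
      push_cast
      field_simp
      linear_combination (-2 : ℝ) * h
  rw [hpoch] at hchoose
  exact mul_left_cancel₀ (by positivity) hchoose

theorem Real.hasSum_centralBinom_div_mul_pow {x : ℝ} (hx : |x| < 1) :
    HasSum (fun n : ℕ => (n.centralBinom : ℝ) / 4 ^ n * x ^ n) (1 / √(1 - x)) := by
  have h := (Real.one_div_one_sub_rpow_hasFPowerSeriesOnBall_zero (1 / 2)).hasSum (y := x)
    (by simpa [enorm_eq_nnnorm, ← NNReal.coe_lt_coe] using hx)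
  simpa [FormalMultilinearSeries.ofScalars_apply_eq, Real.sqrt_eq_rpow,
    ← Ring.choose_half_add_sub_one_eq_centralBinom_div, mul_comm] using h

theorem Real.hasSum_arcsin {x : ℝ} (hx : |x| < 1) :
    HasSum (fun n : ℕ => (n.centralBinom : ℝ) / 4 ^ n / (2 * n + 1) * x ^ (2 * n + 1))
      (Real.arcsin x) := by
  obtain ⟨r, hxr, hr1⟩ := exists_between hx
  have hr0 : 0 < r := (abs_nonneg x).trans_lt hxr
  have hr2 : |r ^ 2| < 1 := by
    rw [abs_of_nonneg (by positivity)]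
    nlinarith
  set g : ℕ → ℝ → ℝ := fun n y =>
    (n.centralBinom : ℝ) / 4 ^ n / (2 * n + 1) * y ^ (2 * n + 1) with hg
  set g' : ℕ → ℝ → ℝ := fun n y => (n.centralBinom : ℝ) / 4 ^ n * (y ^ 2) ^ n with hg'
  have hu : Summable fun n : ℕ => (n.centralBinom : ℝ) / 4 ^ n * (r ^ 2) ^ n :=
    (Real.hasSum_centralBinom_div_mul_pow hr2).summable
  have hsq : ∀ y ∈ Set.Ioo (-r) r, y ^ 2 < r ^ 2 := fun y hy =>
    sq_lt_sq' hy.1 hy.2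
  have hderiv : ∀ n, ∀ y ∈ Set.Ioo (-r) r, HasDerivAt (g n) (g' n y) y := by
    intro n y _
    refine ((hasDerivAt_pow (2 * n + 1) y).const_mul
      ((n.centralBinom : ℝ) / 4 ^ n / (2 * n + 1))).congr_deriv ?_
    simp only [hg', Nat.add_sub_cancel, pow_mul]
    push_cast
    field_simp
  have hbound : ∀ n, ∀ y ∈ Set.Ioo (-r) r,
      ‖g' n y‖ ≤ (n.centralBinom : ℝ) / 4 ^ n * (r ^ 2) ^ n := by
    intro n y hy
    rw [Real.norm_of_nonneg (by positivity)]
    have := (hsq y hy).le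
    simp only [hg']
    gcongr
  have h0 : (0 : ℝ) ∈ Set.Ioo (-r) r := ⟨by linarith, hr0⟩
  have hxmem : x ∈ Set.Ioo (-r) r := abs_lt.mp hxr
  have hg0 : ∀ n, g n 0 = 0 := fun n => by simp [hg]
  have hs0 : Summable fun n => g n 0 := by simp [hg0, summable_zero]
  have hsum : Summable fun n => g n x :=
    summable_of_summable_hasDerivAt_of_isPreconnected hu isOpen_Ioo isPreconnected_Ioo
      hderiv hbound h0 hs0 hxmem
  have htsum : ∀ y ∈ Set.Ioo (-r) r,
      HasDerivAt (fun z => ∑' n, g n z) (1 / √(1 - y ^ 2)) y := by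
    intro y hy
    have h := hasDerivAt_tsum_of_isPreconnected hu isOpen_Ioo isPreconnected_Ioo
      hderiv hbound h0 hs0 hy
    rwa [(Real.hasSum_centralBinom_div_mul_pow (x := y ^ 2) (by
      rw [abs_of_nonneg (by positivity)] at hr2 ⊢
      exact (hsq y hy).trans hr2)).tsum_eq] at h
  have harcsin : ∀ y ∈ Set.Ioo (-r) r, HasDerivAt Real.arcsin (1 / √(1 - y ^ 2)) y :=
    fun y hy => Real.hasDerivAt_arcsin (by linarith [hy.1]) (by linarith [hy.2])
  have heq := isOpen_Ioo.eqOn_of_deriv_eq isPreconnected_Ioo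
    (fun y hy => (htsum y hy).differentiableAt.differentiableWithinAt)
    (fun y hy => (harcsin y hy).differentiableAt.differentiableWithinAt)
    (fun y hy => (htsum y hy).deriv.trans (harcsin y hy).deriv.symm) h0
    (by simp [hg0]) hxmem
  rw [← heq]
  exact hsum.hasSum

theorem hasDerivAt_cdf_gaussianReal (x : ℝ) :
    HasDerivAt (fun y => cdf (gaussianReal 0 1) y) (gaussianPDFReal 0 1 x) x := by
  have hcont : Continuous (gaussianPDFReal 0 1) := by
    unfold gaussianPDFReal
    fun_prop
  have hint : ∀ s, IntegrableOn (gaussianPDFReal 0 1) s :=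
    fun s => (integrable_gaussianPDFReal 0 1).integrableOn
  have hcdf : ∀ y, cdf (gaussianReal 0 1) y = ∫ z in Set.Iic y, gaussianPDFReal 0 1 z := by
    intro y
    rw [cdf_eq_real, measureReal_def, gaussianReal_apply_eq_integral 0 one_ne_zero,
      ENNReal.toReal_ofReal (integral_nonneg (gaussianPDFReal_nonneg 0 1))]
  have heq : (fun y => cdf (gaussianReal 0 1) y) = fun y =>
      (∫ z in (0 : ℝ)..y, gaussianPDFReal 0 1 z) + cdf (gaussianReal 0 1) 0 := by
    ext y
    rw [hcdf y, hcdf 0, ← intervalIntegral.integral_Iic_sub_Iic (hint _) (hint _)]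
    ring
  rw [heq]
  exact (hcont.integral_hasStrictDerivAt 0 x).hasDerivAt.add_const _

theorem continuous_cdf_gaussianReal : Continuous (fun y => cdf (gaussianReal 0 1) y) :=
  continuous_iff_continuousAt.mpr fun x => (hasDerivAt_cdf_gaussianReal x).continuousAt

theorem cdf_gaussianReal_neg (x : ℝ) :
    cdf (gaussianReal 0 1) (-x) = 1 - cdf (gaussianReal 0 1) x := by
  have : NullSingletonClass (gaussianReal 0 1) := nullSingletonClass_gaussianReal one_ne_zero
  have hmap : (gaussianReal 0 1).map (fun x => -x) = gaussianReal 0 1 := by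
    simpa using gaussianReal_map_neg (μ := 0) (v := 1)
  have hpre : (fun x : ℝ => -x) ⁻¹' Set.Iic (-x) = Set.Ici x := by
    ext
    simp
  rw [cdf_eq_real, cdf_eq_real, ← probReal_compl_eq_one_sub measurableSet_Iic, Set.compl_Iic]
  nth_rewrite 1 [← hmap]
  rw [map_measureReal_apply measurable_neg measurableSet_Iic, hpre]
  exact measureReal_congr Ioi_ae_eq_Ici.symm

theorem cdf_gaussianReal_zero : cdf (gaussianReal 0 1) 0 = 1 / 2 := by
  have h := cdf_gaussianReal_neg 0
  rw [neg_zero] at h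
  linarith

theorem norm_cdf_le_one (μ : Measure ℝ) (x : ℝ) : ‖cdf μ x‖ ≤ 1 := by
  rw [Real.norm_of_nonneg (cdf_nonneg μ x)]
  exact cdf_le_one μ x

theorem integrable_cdf_gaussianReal :
    Integrable (fun x => cdf (gaussianReal 0 1) x) (gaussianReal 0 1) :=
  .of_bound continuous_cdf_gaussianReal.aestronglyMeasurable 1
    (ae_of_all _ (norm_cdf_le_one _))

theorem integral_cdf_gaussianReal :
    ∫ x, cdf (gaussianReal 0 1) x ∂gaussianReal 0 1 = 1 / 2 := by
  have hmap : (gaussianReal 0 1).map (fun x => -x) = gaussianReal 0 1 := by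
    simpa using gaussianReal_map_neg (μ := 0) (v := 1)
  have h : ∫ x, cdf (gaussianReal 0 1) x ∂gaussianReal 0 1 =
      1 - ∫ x, cdf (gaussianReal 0 1) x ∂gaussianReal 0 1 := by
    calc ∫ x, cdf (gaussianReal 0 1) x ∂gaussianReal 0 1
        = ∫ x, cdf (gaussianReal 0 1) x ∂(gaussianReal 0 1).map (fun x => -x) := by rw [hmap]
      _ = ∫ x, (1 - cdf (gaussianReal 0 1) x) ∂gaussianReal 0 1 := by
        rw [integral_map measurable_neg.aemeasurable
          continuous_cdf_gaussianReal.aestronglyMeasurable]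
        simp_rw [cdf_gaussianReal_neg]
      _ = _ := by
        rw [integral_sub (integrable_const _) integrable_cdf_gaussianReal]
        simp
  linarith

theorem integral_cdf_gaussianReal_add_mul (b s : ℝ) :
    ∫ z, cdf (gaussianReal 0 1) (b + s * z) ∂gaussianReal 0 1 =
      cdf (gaussianReal 0 1) (b / √(1 + s ^ 2)) := by
  have hpos : 0 < √(1 + s ^ 2) := by positivity
  have hlaw : (gaussianReal 0 1).map (fun z => -s * z) ∗ gaussianReal 0 1 =
      (gaussianReal 0 1).map (fun z => √(1 + s ^ 2) * z) := by
    rw [gaussianReal_map_const_mul, gaussianReal_map_const_mul, gaussianReal_conv_gaussianReal]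
    congr 1
    · simp
    · ext
      simp only [neg_sq, mul_one, NNReal.coe_add, NNReal.coe_mk, NNReal.coe_one,
        Real.sq_sqrt (by positivity : 0 ≤ 1 + s ^ 2)]
      ring
  have hmeas : Measurable ((Set.Iic b).indicator (1 : ℝ → ENNReal)) :=
    measurable_one.indicator measurableSet_Iic
  have hpre : (fun z => √(1 + s ^ 2) * z) ⁻¹' Set.Iic b = Set.Iic (b / √(1 + s ^ 2)) := by
    ext z
    simp [le_div_iff₀ hpos, mul_comm]
  have hshift : ∀ x, ∫⁻ y, (Set.Iic b).indicator (1 : ℝ → ENNReal) (x + y) ∂gaussianReal 0 1 =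
      gaussianReal 0 1 (Set.Iic (b - x)) := by
    intro x
    rw [← lintegral_indicator_one measurableSet_Iic]
    congr 1 with y
    simp [Set.indicator_apply, le_sub_iff_add_le']
  have hmeas' : Measurable fun x => gaussianReal 0 1 (Set.Iic (b - x)) := by
    simp_rw [← ofReal_cdf]
    exact (continuous_cdf_gaussianReal.comp
      (by fun_prop : Continuous fun x => b - x)).measurable.ennreal_ofReal
  have hlin : ∫⁻ z, ENNReal.ofReal (cdf (gaussianReal 0 1) (b + s * z)) ∂gaussianReal 0 1 =
      ENNReal.ofReal (cdf (gaussianReal 0 1) (b / √(1 + s ^ 2))) := by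
    rw [ofReal_cdf, ← hpre, ← Measure.map_apply (by fun_prop) measurableSet_Iic, ← hlaw,
      ← lintegral_indicator_one measurableSet_Iic, Measure.lintegral_conv hmeas]
    simp_rw [hshift]
    rw [lintegral_map hmeas' (by fun_prop)]
    simp [ofReal_cdf]
  rw [integral_eq_lintegral_of_nonneg_ae (ae_of_all _ fun z => cdf_nonneg _ _)
    (continuous_cdf_gaussianReal.comp (by fun_prop)).aestronglyMeasurable, hlin,
    ENNReal.toReal_ofReal (cdf_nonneg _ _)]

theorem integral_id_mul_cdf_mul_pdf_gaussianReal (a : ℝ) :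
    ∫ z, z * (cdf (gaussianReal 0 1) z * gaussianPDFReal 0 1 (a * z)) ∂gaussianReal 0 1 =
      1 / (2 * Real.pi) * (1 / ((1 + a ^ 2) * √(2 + a ^ 2))) := by
  set c : ℝ := (1 + a ^ 2) / 2 with hc
  have hcpos : 0 < c := by positivity
  have hv : ∀ x : ℝ, HasDerivAt (fun x => Real.exp (-c * x ^ 2))
      (-(1 + a ^ 2) * (x * Real.exp (-c * x ^ 2))) x := by
    intro x
    convert ((hasDerivAt_pow 2 x).const_mul (-c)).exp using 1
    simp only [hc]
    push_cast
    ring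
  have hpdf : ∀ x : ℝ, gaussianPDFReal 0 1 x = (√(2 * Real.pi))⁻¹ * Real.exp (-(1 / 2) * x ^ 2) := by
    intro x
    simp only [gaussianPDFReal, NNReal.coe_one, mul_one, sub_zero]
    ring_nf
  have hprod : ∀ x : ℝ, gaussianPDFReal 0 1 x * Real.exp (-c * x ^ 2) =
      (√(2 * Real.pi))⁻¹ * Real.exp (-(c + 1 / 2) * x ^ 2) := by
    intro x
    rw [hpdf, mul_assoc, ← Real.exp_add]
    ring_nf
  have hbdd : ∀ {f : ℝ → ℝ}, Integrable f →
      Integrable (fun x => cdf (gaussianReal 0 1) x * f x) := fun hf =>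
    hf.bdd_mul continuous_cdf_gaussianReal.aestronglyMeasurable
      (ae_of_all _ (norm_cdf_le_one _))
  have hparts := integral_mul_deriv_eq_deriv_mul_of_integrable
    (fun x _ => hasDerivAt_cdf_gaussianReal x) (fun x _ => hv x)
    (hbdd ((integrable_mul_exp_neg_mul_sq hcpos).const_mul _))
    (by
      refine ((integrable_exp_neg_mul_sq (b := c + 1 / 2) (by positivity)).const_mul
        (√(2 * Real.pi))⁻¹).congr (ae_of_all _ fun x => ?_)
      exact (hprod x).symm)
    (hbdd (integrable_exp_neg_mul_sq hcpos))
  simp_rw [hprod] at hparts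
  rw [integral_const_mul, integral_gaussian] at hparts
  have hpull : ∫ x, cdf (gaussianReal 0 1) x * (-(1 + a ^ 2) * (x * Real.exp (-c * x ^ 2))) =
      -(1 + a ^ 2) * ∫ x, cdf (gaussianReal 0 1) x * (x * Real.exp (-c * x ^ 2)) := by
    rw [← integral_const_mul]
    congr 1 with x
    ring
  rw [hpull] at hparts
  have hgoal : ∫ z, z * (cdf (gaussianReal 0 1) z * gaussianPDFReal 0 1 (a * z)) ∂gaussianReal 0 1 =
      1 / (2 * Real.pi) * ∫ x, cdf (gaussianReal 0 1) x * (x * Real.exp (-c * x ^ 2)) := by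
    rw [integral_gaussianReal_eq_integral_smul one_ne_zero, ← integral_const_mul]
    congr 1 with x
    have hexp : Real.exp (-c * x ^ 2) =
        Real.exp (-(1 / 2) * x ^ 2) * Real.exp (-(1 / 2) * (a * x) ^ 2) := by
      rw [← Real.exp_add]
      congr 1
      ring
    have hsq : (√(2 * Real.pi))⁻¹ * (√(2 * Real.pi))⁻¹ = 1 / (2 * Real.pi) := by
      rw [← mul_inv, Real.mul_self_sqrt (by positivity), one_div]
    rw [hpdf, hpdf, hexp, ← hsq, smul_eq_mul]
    ring
  have hsqrt : (√(2 * Real.pi))⁻¹ * √(Real.pi / (c + 1 / 2)) = 1 / √(2 + a ^ 2) := by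
    rw [← Real.sqrt_inv, ← Real.sqrt_mul (by positivity), one_div (√_), ← Real.sqrt_inv]
    congr 1
    simp only [hc]
    field_simp
    ring
  rw [hsqrt] at hparts
  rw [hgoal]
  congr 1
  have : 0 < √(2 + a ^ 2) := by positivity
  rw [eq_div_iff (by positivity)]
  linear_combination (-√(2 + a ^ 2)) * hparts + one_div_mul_cancel this.ne'

theorem hasDerivAt_integral_cdf_mul_cdf_gaussianReal (a : ℝ) :
    HasDerivAt (fun a => ∫ z, cdf (gaussianReal 0 1) z * cdf (gaussianReal 0 1) (a * z)
      ∂gaussianReal 0 1) (1 / (2 * Real.pi) * (1 / ((1 + a ^ 2) * √(2 + a ^ 2)))) a := by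
  have hpdfc : Continuous (gaussianPDFReal 0 1) := by
    unfold gaussianPDFReal
    fun_prop
  have hΦ := continuous_cdf_gaussianReal
  have hcont : ∀ a : ℝ, Continuous fun z =>
      cdf (gaussianReal 0 1) z * cdf (gaussianReal 0 1) (a * z) := fun a =>
    hΦ.mul (hΦ.comp (continuous_const_mul a))
  have hpdf_le : ∀ x, gaussianPDFReal 0 1 x ≤ (√(2 * Real.pi))⁻¹ := by
    intro x
    simp only [gaussianPDFReal, NNReal.coe_one, mul_one, sub_zero]
    refine mul_le_of_le_one_right (by positivity) (Real.exp_le_one_iff.mpr ?_)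
    have := sq_nonneg x
    linarith
  rw [← integral_id_mul_cdf_mul_pdf_gaussianReal]
  refine (hasDerivAt_integral_of_dominated_loc_of_deriv_le (s := Set.univ)
    (F := fun a z => cdf (gaussianReal 0 1) z * cdf (gaussianReal 0 1) (a * z))
    (F' := fun a z => z * (cdf (gaussianReal 0 1) z * gaussianPDFReal 0 1 (a * z)))
    (bound := fun z => |z| * (√(2 * Real.pi))⁻¹)
    Filter.univ_mem (.of_forall fun a => (hcont a).aestronglyMeasurable) ?_ ?_ ?_ ?_ ?_).2
  · refine .of_bound (hcont a).aestronglyMeasurable 1 (ae_of_all _ fun z => ?_)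
    rw [norm_mul]
    exact mul_le_one₀ (norm_cdf_le_one _ _) (norm_nonneg _) (norm_cdf_le_one _ _)
  · exact (continuous_id.mul (hΦ.mul
      (hpdfc.comp (continuous_const_mul a)))).aestronglyMeasurable
  · refine ae_of_all _ fun z a _ => ?_
    rw [norm_mul, norm_mul, Real.norm_eq_abs z,
      Real.norm_of_nonneg (gaussianPDFReal_nonneg 0 1 (a * z))]
    gcongr
    exact (mul_le_of_le_one_left (gaussianPDFReal_nonneg 0 1 _) (norm_cdf_le_one _ _)).trans
      (hpdf_le _)
  · exact ((memLp_id_gaussianReal (μ := 0) (v := 1) 1).integrable (by simp)).abs.mul_const _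
  · refine ae_of_all _ fun z a _ => ?_
    refine (((hasDerivAt_cdf_gaussianReal (a * z)).comp a
      (hasDerivAt_mul_const z)).const_mul (cdf (gaussianReal 0 1) z)).congr_deriv ?_
    ring

theorem hasDerivAt_arctan_div_sqrt_two_add_sq (a : ℝ) :
    HasDerivAt (fun a => Real.arctan (a / √(2 + a ^ 2)))
      (1 / ((1 + a ^ 2) * √(2 + a ^ 2))) a := by
  have hpos : 0 < 2 + a ^ 2 := by positivity
  have hs : √(2 + a ^ 2) ^ 2 = 2 + a ^ 2 := Real.sq_sqrt hpos.le
  have hsp : 0 < √(2 + a ^ 2) := Real.sqrt_pos.mpr hpos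
  have hden : HasDerivAt (fun a : ℝ => √(2 + a ^ 2)) (a / √(2 + a ^ 2)) a := by
    convert ((hasDerivAt_pow 2 a).const_add 2).sqrt hpos.ne' using 1
    push_cast
    field_simp
  refine ((hasDerivAt_id' a).fun_div hden hsp.ne').arctan.congr_deriv ?_
  simp only [div_pow, hs]
  field_simp
  rw [hs]
  ring

theorem integral_cdf_mul_cdf_mul_gaussianReal (a : ℝ) :
    ∫ z, cdf (gaussianReal 0 1) z * cdf (gaussianReal 0 1) (a * z) ∂gaussianReal 0 1 =
      1 / 4 + 1 / (2 * Real.pi) * Real.arctan (a / √(2 + a ^ 2)) := by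
  have hderiv : ∀ a, HasDerivAt (fun a =>
      (∫ z, cdf (gaussianReal 0 1) z * cdf (gaussianReal 0 1) (a * z) ∂gaussianReal 0 1) -
        1 / (2 * Real.pi) * Real.arctan (a / √(2 + a ^ 2))) 0 a := by
    intro a
    exact ((hasDerivAt_integral_cdf_mul_cdf_gaussianReal a).sub
      ((hasDerivAt_arctan_div_sqrt_two_add_sq a).const_mul (1 / (2 * Real.pi)))).congr_deriv
      (sub_self _)
  have h := is_const_of_deriv_eq_zero (fun a => (hderiv a).differentiableAt)
    (fun a => (hderiv a).deriv) a 0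
  simp only [zero_mul, zero_div, Real.arctan_zero, mul_zero, sub_zero, integral_mul_const,
    integral_cdf_gaussianReal, cdf_gaussianReal_zero] at h
  linarith

theorem integral_cdf_mul_cdf_correlated_gaussianReal (ρ : ℝ) (hρ : ρ ∈ Set.Icc (-1 : ℝ) 1) :
    ∫ x, ∫ z, cdf (gaussianReal 0 1) x * cdf (gaussianReal 0 1) (ρ * x + √(1 - ρ ^ 2) * z)
      ∂gaussianReal 0 1 ∂gaussianReal 0 1 =
      1 / 4 + 1 / (2 * Real.pi) * Real.arcsin (ρ / 2) := by
  have hρ2 : ρ ^ 2 ≤ 1 := by nlinarith [hρ.1, hρ.2]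
  have hpos : 0 < 2 - ρ ^ 2 := by linarith
  have hpos' : 0 < 4 - ρ ^ 2 := by linarith
  simp_rw [integral_const_mul, integral_cdf_gaussianReal_add_mul, mul_div_right_comm]
  rw [integral_cdf_mul_cdf_mul_gaussianReal, Real.sq_sqrt (by linarith),
    Real.arcsin_eq_arctan ⟨by linarith [hρ.1], by linarith [hρ.2]⟩]
  have h1 : 1 + (1 - ρ ^ 2) = 2 - ρ ^ 2 := by ring
  have h2 : 2 + (ρ / √(2 - ρ ^ 2)) ^ 2 = (4 - ρ ^ 2) / (2 - ρ ^ 2) := by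
    rw [div_pow, Real.sq_sqrt hpos.le]
    field_simp
    ring
  have h3 : 1 - (ρ / 2) ^ 2 = (4 - ρ ^ 2) / 2 ^ 2 := by ring
  have hs := Real.sqrt_pos.mpr hpos
  have hs' := Real.sqrt_pos.mpr hpos'
  rw [h1, h2, h3, Real.sqrt_div hpos'.le, Real.sqrt_div hpos'.le,
    Real.sqrt_sq (by norm_num : (0 : ℝ) ≤ 2)]
  congr 3
  field_simp

theorem integrable_comp_prod_cdf_mul_cdf_gaussianReal (ρ s : ℝ) :
    Integrable (fun p : ℝ × ℝ =>
      cdf (gaussianReal 0 1) p.1 * cdf (gaussianReal 0 1) (ρ * p.1 + s * p.2))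
      ((gaussianReal 0 1).prod (gaussianReal 0 1)) := by
  have hcont : Continuous fun p : ℝ × ℝ =>
      cdf (gaussianReal 0 1) p.1 * cdf (gaussianReal 0 1) (ρ * p.1 + s * p.2) :=
    (continuous_cdf_gaussianReal.comp continuous_fst).mul
      (continuous_cdf_gaussianReal.comp (by fun_prop))
  refine .of_bound hcont.aestronglyMeasurable 1 (ae_of_all _ fun p => ?_)
  rw [norm_mul]
  exact mul_le_one₀ (norm_cdf_le_one _ _) (norm_nonneg _) (norm_cdf_le_one _ _)

theorem arcsin_coeff_eq_hermite_coeff (ρ : ℝ) (q : ℕ) :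
    1 / (2 * Real.pi) *
        ((q.centralBinom : ℝ) / 4 ^ q / (2 * q + 1) * (ρ / 2) ^ (2 * q + 1)) =
      ((-1 : ℝ) ^ q /
          (√Real.pi * (2 * (q : ℝ) + 1) * 2 ^ (2 * q + 1) * (q.factorial : ℝ))) ^ 2 *
        ((2 * q + 1).factorial : ℝ) * ρ ^ (2 * q + 1) := by
  have hbinom : (q.centralBinom : ℝ) * (q.factorial : ℝ) ^ 2 = ((2 * q).factorial : ℝ) := by
    rw [Nat.centralBinom_eq_two_mul_choose]
    have h := Nat.choose_mul_factorial_mul_factorial (show q ≤ 2 * q by omega)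
    rw [show 2 * q - q = q by omega] at h
    rw [← h]
    push_cast
    ring
  have hsign : ((-1 : ℝ) ^ q) ^ 2 = 1 := by rw [← pow_mul, mul_comm, pow_mul]; simp
  have hfour : (4 : ℝ) ^ q = 2 ^ (2 * q) := by rw [pow_mul]; norm_num
  have hpi := Real.pi_pos
  rw [Nat.factorial_succ, div_pow ρ, div_pow ((-1 : ℝ) ^ q), hsign, mul_pow, mul_pow, mul_pow,
    Real.sq_sqrt hpi.le, hfour]
  push_cast
  rw [← hbinom]
  field_simp
  ring

/-- For jointly centered Gaussian `(X, Y)` with unit variances and correlation `ρ`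
(realized as `X = Z₁`, `Y = ρZ₁ + √(1-ρ²)Z₂` for independent standard Gaussians
`Z₁, Z₂`), with `Φ` the standard normal CDF,
`E[Φ(X)Φ(Y)] = 1/4 + ∑_{q≥0} ℓ_{2q+1}² (2q+1)! ρ^{2q+1}` where
`ℓ_{2q+1} = (-1)^q / (√π (2q+1) 2^{2q+1} q!)`. -/
theorem expectation_Phi_mul_Phi_series
    {Ω : Type*} [MeasureSpace Ω] [IsProbabilityMeasure (ℙ : Measure Ω)]
    (Z₁ Z₂ : Ω → ℝ) (hZ₁ : Measurable Z₁) (hZ₂ : Measurable Z₂)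
    (hind : IndepFun Z₁ Z₂ ℙ)
    (hlaw₁ : Measure.map Z₁ ℙ = gaussianReal 0 1)
    (hlaw₂ : Measure.map Z₂ ℙ = gaussianReal 0 1)
    (ρ : ℝ) (hρ : ρ ∈ Set.Icc (-1 : ℝ) 1)
    (X Y : Ω → ℝ) (hX : X = Z₁)
    (hY : Y = fun ω => ρ * Z₁ ω + Real.sqrt (1 - ρ ^ 2) * Z₂ ω) :
    HasSum (fun q : ℕ =>
        ((-1 : ℝ) ^ q /
            (Real.sqrt Real.pi * (2 * (q : ℝ) + 1) * 2 ^ (2 * q + 1) *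
              (Nat.factorial q : ℝ))) ^ 2 *
          (Nat.factorial (2 * q + 1) : ℝ) * ρ ^ (2 * q + 1))
      ((∫ ω, cdf (gaussianReal 0 1) (X ω) * cdf (gaussianReal 0 1) (Y ω)) - 1 / 4) := by
  subst hX hY
  have hmap : (ℙ : Measure Ω).map (fun ω => (X ω, Z₂ ω)) =
      (gaussianReal 0 1).prod (gaussianReal 0 1) := by
    rw [(indepFun_iff_map_prod_eq_prod_map_map hZ₁.aemeasurable hZ₂.aemeasurable).mp hind,
      hlaw₁, hlaw₂]
  have hint := integrable_comp_prod_cdf_mul_cdf_gaussianReal ρ √(1 - ρ ^ 2)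
  have hexp : ∫ ω, cdf (gaussianReal 0 1) (X ω) *
      cdf (gaussianReal 0 1) (ρ * X ω + √(1 - ρ ^ 2) * Z₂ ω) =
      1 / 4 + 1 / (2 * Real.pi) * Real.arcsin (ρ / 2) := by
    rw [← integral_cdf_mul_cdf_correlated_gaussianReal ρ hρ, ← integral_prod _ hint, ← hmap,
      integral_map (hZ₁.prodMk hZ₂).aemeasurable (hmap ▸ hint.aestronglyMeasurable)]
  have habs : |ρ / 2| < 1 := abs_lt.mpr ⟨by linarith [hρ.1], by linarith [hρ.2]⟩
  rw [hexp, add_sub_cancel_left]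
  refine ((Real.hasSum_arcsin habs).mul_left (1 / (2 * Real.pi))).congr_fun ?_
  exact fun q => (arcsin_coeff_eq_hermite_coeff ρ q).symm
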